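/- Let k and a be integers with 2 ≤ a ≤ k, k odd, and a even, and let q be a complex number with |q| < 1. Then (−q²; q²)_∞ (q^a, q^{2k+2−a}, q^{2k+2}; q^{2k+2})_∞ / (q²; q²)_∞ = ∑_{n_1,…,n_{k−1} ≥ 0} q^{N_1² + ⋯ + N_{k−1}² + n_1 + n_3 + ⋯ + n_{a−3} + N_{a−1} + N_a + ⋯ + N_{k−1}} / ((q²;q²)_{n_1} (q²;q²)_{n_2} ⋯ (q²;q²)_{n_{k−1}}), where n_1 + n_3 + ⋯ + n_{a−3} runs over odd subscripts up to a−3 (this list being empty if a = 2), and the sum converges absolutely. -/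

import Mathlib

open Finset

/-- Finite q-Pochhammer symbol `(x;q)_n`. -/
noncomputable def qPoch (q x : ℂ) (n : ℕ) : ℂ :=
  ∏ j ∈ Finset.range n, (1 - x * q ^ j)

/-- Infinite q-Pochhammer symbol `(x;q)_∞`. -/
noncomputable def qPochInf (q x : ℂ) : ℂ :=
  ∏' j : ℕ, (1 - x * q ^ j)

/-- `Nsum m n i = n_i + n_{i+1} + ⋯ + n_m` (1-based), where `n : Fin m → ℕ` lists
`n_1, …, n_m`; in particular `Nsum m n i = 0` for `i > m`. -/
def Nsum (m : ℕ) (n : Fin m → ℕ) (i : ℕ) : ℕ :=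
  ∑ j : Fin m, if i ≤ (j : ℕ) + 1 then n j else 0

/-- Summand of Andrews' multisum in identity for `\overline{W}_{k,a}` with `k` odd and
`a` even: exponent `N_1² + ⋯ + N_{k-1}² + n_1 + n_3 + ⋯ + n_{a-3} + N_{a-1} + N_a + ⋯ + N_{k-1}`
(note `n_i = N_i - N_{i+1}`), denominator `(q²;q²)_{n_1} ⋯ (q²;q²)_{n_{k-1}}`. -/
noncomputable def owTerm (k a : ℕ) (q : ℂ) (n : Fin (k - 1) → ℕ) : ℂ :=
  q ^ ((∑ i ∈ Finset.Icc 1 (k - 1), (Nsum (k - 1) n i) ^ 2) +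
        (∑ i ∈ (Finset.Icc 1 (a - 3)).filter (fun i => i % 2 = 1),
          (Nsum (k - 1) n i - Nsum (k - 1) n (i + 1))) +
        ∑ i ∈ Finset.Icc (a - 1) (k - 1), Nsum (k - 1) n i) /
    ∏ j : Fin (k - 1), qPoch (q ^ 2) (q ^ 2) (n j)

section Pochhammer

variable {Q : ℂ}

lemma qPoch_zero (Q x : ℂ) : qPoch Q x 0 = 1 := by simp [qPoch]

lemma qPoch_succ (Q x : ℂ) (n : ℕ) :
    qPoch Q x (n + 1) = qPoch Q x n * (1 - x * Q ^ n) := by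
  simp [qPoch, prod_range_succ]

lemma qPoch_self_succ (Q : ℂ) (n : ℕ) :
    qPoch Q Q (n + 1) = qPoch Q Q n * (1 - Q ^ (n + 1)) := by
  rw [qPoch_succ, pow_succ']

lemma qPoch_add (Q x : ℂ) (m n : ℕ) :
    qPoch Q x (m + n) = qPoch Q x m * qPoch Q (x * Q ^ m) n := by
  simp only [qPoch, prod_range_add, pow_add, mul_assoc]

lemma qPoch_succ_left (Q x : ℂ) (n : ℕ) :
    qPoch Q x (n + 1) = (1 - x) * qPoch Q (x * Q) n := by
  rw [add_comm, qPoch_add, qPoch_succ, qPoch_zero]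
  simp

lemma one_sub_pow_succ_ne_zero (hQ : ‖Q‖ < 1) (n : ℕ) : 1 - Q ^ (n + 1) ≠ 0 := by
  intro h
  have h1 : ‖Q ^ (n + 1)‖ < 1 := by
    rw [norm_pow]
    exact pow_lt_one₀ (norm_nonneg _) hQ n.succ_ne_zero
  rw [← sub_eq_zero.mp h] at h1
  simp at h1

lemma one_add_pow_ne_zero (hQ : ‖Q‖ < 1) (n : ℕ) : 1 + Q ^ n ≠ 0 := by
  rcases n with _ | n
  · norm_num
  intro h
  have h1 : ‖Q ^ (n + 1)‖ < 1 := by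
    rw [norm_pow]
    exact pow_lt_one₀ (norm_nonneg _) hQ n.succ_ne_zero
  rw [← neg_eq_of_add_eq_zero_right h] at h1
  simp at h1

lemma qPoch_self_ne_zero (hQ : ‖Q‖ < 1) (n : ℕ) : qPoch Q Q n ≠ 0 := by
  refine prod_ne_zero_iff.mpr fun j _ => ?_
  rw [← pow_succ']
  exact one_sub_pow_succ_ne_zero hQ j

lemma qPoch_neg_one_ne_zero (hQ : ‖Q‖ < 1) (n : ℕ) : qPoch Q (-1) n ≠ 0 := by
  refine prod_ne_zero_iff.mpr fun j _ => ?_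
  simpa using one_add_pow_ne_zero hQ j

lemma qPoch_neg_self_ne_zero (hQ : ‖Q‖ < 1) (n : ℕ) : qPoch Q (-Q) n ≠ 0 := by
  refine prod_ne_zero_iff.mpr fun j _ => ?_
  have := one_add_pow_ne_zero hQ (j + 1)
  rwa [neg_mul, sub_neg_eq_add, ← pow_succ']

lemma choose_two_add (m n : ℕ) :
    (m + n).choose 2 = m.choose 2 + n.choose 2 + m * n := by
  induction n with
  | zero => simp
  | succ n ih =>
    rw [← add_assoc, Nat.choose_succ_succ' (m + n) 1, Nat.choose_succ_succ' n 1, ih]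
    simp only [Nat.choose_one_right]
    ring

lemma choose_two_succ (n : ℕ) : (n + 1).choose 2 = n.choose 2 + n := by
  simpa using choose_two_add n 1

lemma sq_eq_two_mul_choose_two_add (n : ℕ) : n ^ 2 = 2 * n.choose 2 + n := by
  induction n with
  | zero => simp
  | succ n ih =>
    rw [choose_two_succ]
    linarith

/-- The terminating `q`-Chu–Vandermonde summation, in a division-free form in `b` and `d`. -/
lemma q_chu_vandermonde (hQ : ‖Q‖ < 1) (d : ℂ) (n : ℕ) (b : ℂ) :
    ∑ p ∈ antidiagonal n, qPoch Q b p.1 * (-d) ^ p.1 * Q ^ p.1.choose 2 *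
        qPoch Q (b * d * Q ^ p.1) p.2 / (qPoch Q Q p.1 * qPoch Q Q p.2) =
      qPoch Q d n / qPoch Q Q n := by
  induction n generalizing b with
  | zero => simp [qPoch_zero]
  | succ n ih =>
    have hP := qPoch_self_ne_zero hQ
    have h1 := one_sub_pow_succ_ne_zero hQ
    refine mul_left_cancel₀ (h1 n) ?_
    set t : ℂ → ℕ → ℕ → ℂ := fun b m l => qPoch Q b m * (-d) ^ m * Q ^ m.choose 2 *
        qPoch Q (b * d * Q ^ m) l / (qPoch Q Q m * qPoch Q Q l) with ht
    have hleft : ∑ p ∈ antidiagonal (n + 1), (1 - Q ^ p.2) * t b p.1 p.2 =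
        (1 - b * d * Q ^ n) * ∑ p ∈ antidiagonal n, t b p.1 p.2 := by
      rw [Nat.sum_antidiagonal_succ', mul_sum]
      simp only [pow_zero, sub_self, zero_mul, zero_add]
      refine sum_congr rfl fun p hp => ?_
      have hn : n = p.1 + p.2 := (mem_antidiagonal.mp hp).symm
      have e1 := hP p.1
      have e2 := hP p.2
      have e3 := h1 p.2
      simp only [ht, qPoch_self_succ, qPoch_succ Q (b * d * Q ^ p.1), hn]
      field_simp
      ring
    have hright : ∑ p ∈ antidiagonal (n + 1), Q ^ p.2 * (1 - Q ^ p.1) * t b p.1 p.2 =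
        -((1 - b) * d * Q ^ n) * ∑ p ∈ antidiagonal n, t (b * Q) p.1 p.2 := by
      rw [Nat.sum_antidiagonal_succ, mul_sum]
      simp only [pow_zero, sub_self, zero_mul, zero_add, mul_zero]
      refine sum_congr rfl fun p hp => ?_
      have hn : n = p.1 + p.2 := (mem_antidiagonal.mp hp).symm
      have e1 := hP p.1
      have e2 := hP p.2
      have e4 : 1 - Q ^ (p.1 + 1) ≠ 0 := h1 p.1
      have e5 : b * d * Q ^ (p.1 + 1) = b * Q * d * Q ^ p.1 := by ring
      simp only [ht, e5, qPoch_self_succ Q, qPoch_succ_left Q b, hn, choose_two_succ]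
      field_simp
      ring
    have hsplit : (1 - Q ^ (n + 1)) * ∑ p ∈ antidiagonal (n + 1), t b p.1 p.2 =
        ∑ p ∈ antidiagonal (n + 1), (1 - Q ^ p.2) * t b p.1 p.2 +
        ∑ p ∈ antidiagonal (n + 1), Q ^ p.2 * (1 - Q ^ p.1) * t b p.1 p.2 := by
      rw [mul_sum, ← sum_add_distrib]
      refine sum_congr rfl fun p hp => ?_
      rw [← mem_antidiagonal.mp hp]
      ring
    rw [hsplit, hleft, hright, ih, ih, qPoch_self_succ, qPoch_succ]
    have e2 := hP n
    have e4 : 1 - Q ^ (n + 1) ≠ 0 := h1 n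
    field_simp
    ring

end Pochhammer

section Bailey

variable {Q : ℂ}

/-- The sequence `β_N`, multiplied by `(b;Q)_N`, of the Bailey pair relative to `Q ^ e` whose other
half is `α`, up to normalization. -/
noncomputable def baileySum (Q b : ℂ) (e : ℕ) (α : ℕ → ℂ) (N : ℕ) : ℂ :=
  qPoch Q b N * ∑ p ∈ antidiagonal N, α p.1 / (qPoch Q Q p.2 * qPoch Q Q (2 * p.1 + e + p.2))

lemma sum_antidiagonal_assoc (f : ℕ → ℕ → ℕ → ℂ) (N : ℕ) :
    ∑ p ∈ antidiagonal N, ∑ s ∈ antidiagonal p.1, f s.1 s.2 p.2 =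
      ∑ p ∈ antidiagonal N, ∑ s ∈ antidiagonal p.2, f p.1 s.1 s.2 := by
  rw [sum_sigma', sum_sigma']
  refine sum_nbij' (fun x => ⟨(x.2.1, x.2.2 + x.1.2), (x.2.2, x.1.2)⟩)
    (fun x => ⟨(x.1.1 + x.2.1, x.2.2), (x.1.1, x.2.1)⟩) ?_ ?_ ?_ ?_ ?_ <;>
  rintro ⟨⟨i, j⟩, ⟨k, l⟩⟩ h <;>
  simp only [mem_sigma, HasAntidiagonal.mem_antidiagonal] at h ⊢ <;>
  obtain ⟨rfl, rfl⟩ := h <;> simp [add_assoc]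

lemma bailey_kernel (hQ : ‖Q‖ < 1) {b d : ℂ} {e : ℕ} (hbd : b * d = Q ^ (e + 1))
    (hd : ∀ n, qPoch Q d n ≠ 0) (r n : ℕ) :
    ∑ s ∈ antidiagonal n, (-d) ^ (r + s.1) * Q ^ (r + s.1).choose 2 * qPoch Q b (r + s.1) /
        (qPoch Q Q s.1 * qPoch Q Q (2 * r + e + s.1) * qPoch Q Q s.2) =
      (-d) ^ r * Q ^ r.choose 2 * qPoch Q b r / qPoch Q d r *
        (qPoch Q d (r + n) / (qPoch Q Q n * qPoch Q Q (2 * r + e + n))) := by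
  have hP := qPoch_self_ne_zero hQ
  have key := q_chu_vandermonde hQ (d * Q ^ r) n (b * Q ^ r)
  rw [qPoch_add Q d]
  have e1 := hd r
  have e2 := hP n
  have e3 := hP (2 * r + e + n)
  have : (-d) ^ r * Q ^ r.choose 2 * qPoch Q b r / qPoch Q d r *
        (qPoch Q d r * qPoch Q (d * Q ^ r) n / (qPoch Q Q n * qPoch Q Q (2 * r + e + n))) =
      (-d) ^ r * Q ^ r.choose 2 * qPoch Q b r / qPoch Q Q (2 * r + e + n) *
        (qPoch Q (d * Q ^ r) n / qPoch Q Q n) := by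
    field_simp
  rw [this, ← key, mul_sum]
  refine sum_congr rfl fun s hs => ?_
  rw [← mem_antidiagonal.mp hs]
  have h1 : b * Q ^ r * (d * Q ^ r) * Q ^ s.1 = Q * Q ^ (2 * r + e + s.1) := by
    calc _ = b * d * (Q ^ r * Q ^ r * Q ^ s.1) := by ring
      _ = _ := by rw [hbd]; ring
  have e4 := hP (2 * r + e + s.1)
  have e5 : qPoch Q (Q * Q ^ (2 * r + e + s.1)) s.2 ≠ 0 := by
    have := hP (2 * r + e + s.1 + s.2)
    rw [qPoch_add] at this
    exact right_ne_zero_of_mul this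
  rw [h1, ← add_assoc, qPoch_add Q Q (2 * r + e + s.1), qPoch_add Q b, choose_two_add]
  have e6 := hP s.1
  have e7 := hP s.2
  field_simp
  ring

/-- One step along the Bailey chain. -/
lemma bailey_step (hQ : ‖Q‖ < 1) {b d : ℂ} {e : ℕ} (hbd : b * d = Q ^ (e + 1))
    (hd : ∀ n, qPoch Q d n ≠ 0) (α : ℕ → ℂ) (N : ℕ) :
    ∑ p ∈ antidiagonal N, (-d) ^ p.1 * Q ^ p.1.choose 2 * baileySum Q b e α p.1 / qPoch Q Q p.2 =
      baileySum Q d e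
        (fun r => α r * ((-d) ^ r * Q ^ r.choose 2 * qPoch Q b r / qPoch Q d r)) N := by
  have h1 : ∀ p ∈ antidiagonal N,
      (-d) ^ p.1 * Q ^ p.1.choose 2 * baileySum Q b e α p.1 / qPoch Q Q p.2 =
      ∑ s ∈ antidiagonal p.1, α s.1 * ((-d) ^ (s.1 + s.2) * Q ^ (s.1 + s.2).choose 2 *
        qPoch Q b (s.1 + s.2) /
        (qPoch Q Q s.2 * qPoch Q Q (2 * s.1 + e + s.2) * qPoch Q Q p.2)) := by
    intro p _
    rw [baileySum, mul_sum, mul_sum, sum_div]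
    refine sum_congr rfl fun s hs => ?_
    rw [mem_antidiagonal.mp hs]
    field_simp
  rw [sum_congr rfl h1, sum_antidiagonal_assoc (fun r m x => α r * ((-d) ^ (r + m) *
    Q ^ (r + m).choose 2 * qPoch Q b (r + m) /
      (qPoch Q Q m * qPoch Q Q (2 * r + e + m) * qPoch Q Q x))), baileySum, mul_sum]
  refine sum_congr rfl fun p hp => ?_
  rw [← mul_sum, bailey_kernel hQ hbd hd, mem_antidiagonal.mp hp]
  ring

/-- Passage from a pair relative to `Q` to a pair relative to `1`. -/
lemma baileySum_one_eq_baileySum_zero (hQ : ‖Q‖ < 1) (b : ℂ) {A A' : ℕ → ℂ} (h0 : A' 0 = A 0)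
    (h1 : ∀ r, A' (r + 1) = A (r + 1) - Q ^ (2 * r + 1) * A r) (N : ℕ) :
    baileySum Q b 1 (fun r => A r * (1 - Q ^ (2 * r + 1))) N = baileySum Q b 0 A' N := by
  have hP := qPoch_self_ne_zero hQ
  have hs := one_sub_pow_succ_ne_zero hQ
  rw [baileySum, baileySum]
  congr 1
  have hsplit : ∀ p : ℕ × ℕ, A p.1 * (1 - Q ^ (2 * p.1 + 1)) /
      (qPoch Q Q p.2 * qPoch Q Q (2 * p.1 + 1 + p.2)) =
      A p.1 / (qPoch Q Q p.2 * qPoch Q Q (2 * p.1 + 0 + p.2)) -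
      Q ^ (2 * p.1 + 1) * A p.1 * (1 - Q ^ p.2) /
        (qPoch Q Q p.2 * qPoch Q Q (2 * p.1 + 1 + p.2)) := by
    intro p
    have e1 := hP p.2
    have e2 := hP (2 * p.1 + p.2)
    have e3 : 1 - Q ^ (2 * p.1 + p.2 + 1) ≠ 0 := hs _
    rw [show 2 * p.1 + 1 + p.2 = 2 * p.1 + p.2 + 1 by ring, qPoch_self_succ, add_zero]
    field_simp
    ring
  rw [sum_congr rfl fun p _ => hsplit p, sum_sub_distrib]
  rcases N with _ | n
  · simp [h0]
  rw [Nat.sum_antidiagonal_succ' (f := fun p : ℕ × ℕ => Q ^ (2 * p.1 + 1) * A p.1 *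
    (1 - Q ^ p.2) / (qPoch Q Q p.2 * qPoch Q Q (2 * p.1 + 1 + p.2))),
    Nat.sum_antidiagonal_succ, Nat.sum_antidiagonal_succ]
  simp only [h0, h1, sub_div, sum_sub_distrib, pow_zero, sub_self, mul_zero, zero_div, zero_add]
  rw [add_sub_assoc]
  congr 2
  refine sum_congr rfl fun p _ => ?_
  have e1 := hP p.2
  have e2 := hP (2 * p.1 + 1 + p.2 + 1)
  have e3 : 1 - Q ^ (p.2 + 1) ≠ 0 := hs _
  rw [show 2 * p.1 + 1 + (p.2 + 1) = 2 * p.1 + 1 + p.2 + 1 by ring,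
    show 2 * (p.1 + 1) + 0 + p.2 = 2 * p.1 + 1 + p.2 + 1 by ring, qPoch_self_succ Q p.2]
  field_simp

/-- The unit Bailey pair relative to `1`. -/
lemma baileySum_unit_zero (hQ : ‖Q‖ < 1) (b : ℂ) {α : ℕ → ℂ} (h0 : α 0 = 1)
    (h1 : ∀ r, α (r + 1) = (-1) ^ (r + 1) * Q ^ (r + 1).choose 2 * (1 + Q ^ (r + 1))) (N : ℕ) :
    baileySum Q b 0 α N = if N = 0 then 1 else 0 := by
  have hP := qPoch_self_ne_zero hQ
  have hs := one_sub_pow_succ_ne_zero hQ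
  rcases N with _ | n
  · simp [baileySum, qPoch_zero, h0]
  rw [if_neg n.succ_ne_zero, baileySum]
  refine mul_eq_zero_of_right _ ((mul_right_inj' (hs n)).mp ?_)
  rw [mul_zero, mul_sum]
  have hsplit : ∀ p ∈ antidiagonal (n + 1), (1 - Q ^ (n + 1)) *
      (α p.1 / (qPoch Q Q p.2 * qPoch Q Q (2 * p.1 + 0 + p.2))) =
      (-1) ^ p.1 * Q ^ (p.1 + 1).choose 2 * (1 - Q ^ p.2) /
        (qPoch Q Q p.2 * qPoch Q Q (2 * p.1 + p.2)) +
      (if p.1 = 0 then 0 else (-1) ^ p.1 * Q ^ p.1.choose 2 * (1 - Q ^ (2 * p.1 + p.2)) /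
        (qPoch Q Q p.2 * qPoch Q Q (2 * p.1 + p.2))) := by
    rintro ⟨r, m⟩ hp
    rw [← mem_antidiagonal.mp hp]
    rcases r with _ | r
    · simp [h0, div_eq_mul_inv]
    · simp only [h1, choose_two_succ (r + 1), add_zero, if_neg r.succ_ne_zero]
      ring
  rw [sum_congr rfl hsplit, sum_add_distrib, Nat.sum_antidiagonal_succ', Nat.sum_antidiagonal_succ]
  simp only [pow_zero, sub_self, mul_zero, zero_div, zero_add, if_true, Nat.succ_ne_zero, if_false]
  rw [← sum_add_distrib]
  refine sum_eq_zero fun p _ => ?_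
  have e1 := hP p.2
  have e2 := hP (2 * p.1 + p.2 + 1)
  have e3 : 1 - Q ^ (p.2 + 1) ≠ 0 := hs _
  have e4 : 1 - Q ^ (2 * p.1 + p.2 + 1 + 1) ≠ 0 := hs _
  rw [show 2 * p.1 + (p.2 + 1) = 2 * p.1 + p.2 + 1 by ring,
    show 2 * (p.1 + 1) + p.2 = 2 * p.1 + p.2 + 1 + 1 by ring, qPoch_self_succ Q p.2,
    qPoch_self_succ Q (2 * p.1 + p.2 + 1)]
  field_simp
  ring

end Bailey

section Limits

open Filter Topology

lemma tendsto_sum_antidiagonal {α u v : ℕ → ℂ} {U V : ℂ} (hα : Summable fun r => ‖α r‖)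
    (hu : Tendsto u atTop (𝓝 U)) (hv : Tendsto v atTop (𝓝 V)) :
    Tendsto (fun N => ∑ p ∈ antidiagonal N, α p.1 * (u p.2 * v (2 * p.1 + p.2))) atTop
      (𝓝 ((∑' r, α r) * (U * V))) := by
  obtain ⟨B, hB⟩ := (Metric.isBounded_range_of_tendsto u hu).exists_norm_le
  obtain ⟨C, hC⟩ := (Metric.isBounded_range_of_tendsto v hv).exists_norm_le
  have hB' : ∀ n, ‖u n‖ ≤ B := fun n => hB _ ⟨n, rfl⟩
  have hC' : ∀ n, ‖v n‖ ≤ C := fun n => hC _ ⟨n, rfl⟩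
  have hB0 : 0 ≤ B := (norm_nonneg _).trans (hB' 0)
  have heq : ∀ N, ∑ p ∈ antidiagonal N, α p.1 * (u p.2 * v (2 * p.1 + p.2)) =
      ∑' r, if r ∈ range (N + 1) then α r * (u (N - r) * v (2 * r + (N - r))) else 0 := by
    intro N
    rw [Nat.sum_antidiagonal_eq_sum_range_succ_mk, tsum_eq_sum (s := range (N + 1))]
    · exact sum_congr rfl fun r hr => (if_pos hr).symm
    · exact fun r hr => if_neg hr
  simp_rw [heq]
  rw [← tsum_mul_right]
  refine tendsto_tsum_of_dominated_convergence (bound := fun r => ‖α r‖ * (B * C))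
    (hα.mul_right _) (fun r => ?_) (Eventually.of_forall fun N r => ?_)
  · have h1 : Tendsto (fun N => α r * (u (N - r) * v (2 * r + (N - r)))) atTop
        (𝓝 (α r * (U * V))) := by
      have hs := tendsto_sub_atTop_nat r
      have hs' : Tendsto (fun N => 2 * r + (N - r)) atTop atTop :=
        tendsto_atTop_mono (fun N => Nat.le_add_left _ _) hs
      exact ((hu.comp hs).mul (hv.comp hs')).const_mul _
    refine h1.congr' ?_
    filter_upwards [eventually_ge_atTop r] with N hN
    rw [if_pos (mem_range.mpr (by omega))]
  · split_ifs
    · rw [norm_mul, norm_mul]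
      gcongr
      · exact hB' _
      · exact hC' _
    · rw [norm_zero]
      have := (norm_nonneg _).trans (hC' 0)
      positivity

variable {Q : ℂ}

lemma summable_norm_mul_pow (hQ : ‖Q‖ < 1) (x : ℂ) : Summable fun j : ℕ => ‖-(x * Q ^ j)‖ := by
  simp only [norm_neg, norm_mul, norm_pow]
  exact (summable_geometric_of_lt_one (norm_nonneg _) hQ).mul_left _

lemma tendsto_qPoch (hQ : ‖Q‖ < 1) (x : ℂ) :
    Tendsto (qPoch Q x) atTop (𝓝 (qPochInf Q x)) := by
  have h := multipliable_one_add_of_summable (summable_norm_mul_pow hQ x)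
  simp only [← sub_eq_add_neg] at h
  exact h.hasProd.tendsto_prod_nat

lemma qPochInf_self_ne_zero (hQ : ‖Q‖ < 1) : qPochInf Q Q ≠ 0 := by
  have h := tprod_one_add_ne_zero_of_summable (f := fun j : ℕ => -(Q * Q ^ j)) (fun j => ?_)
    (summable_norm_mul_pow hQ Q)
  · simp only [← sub_eq_add_neg] at h
    exact h
  · rw [← sub_eq_add_neg, ← pow_succ']
    exact one_sub_pow_succ_ne_zero hQ j

lemma tendsto_inv_qPoch_self (hQ : ‖Q‖ < 1) :
    Tendsto (fun n => (qPoch Q Q n)⁻¹) atTop (𝓝 (qPochInf Q Q)⁻¹) :=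
  (tendsto_qPoch hQ Q).inv₀ (qPochInf_self_ne_zero hQ)

lemma tendsto_baileySum_zero (hQ : ‖Q‖ < 1) (b : ℂ) {α : ℕ → ℂ} (hα : Summable fun r => ‖α r‖) :
    Tendsto (baileySum Q b 0 α) atTop
      (𝓝 (qPochInf Q b * ((∑' r, α r) * ((qPochInf Q Q)⁻¹ * (qPochInf Q Q)⁻¹)))) := by
  refine ((tendsto_qPoch hQ b).mul (tendsto_sum_antidiagonal hα (tendsto_inv_qPoch_self hQ)
    (tendsto_inv_qPoch_self hQ))).congr fun N => ?_
  simp only [baileySum, add_zero, div_eq_mul_inv, mul_inv]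

end Limits

section TripleProduct

open Filter Topology

variable {Q : ℂ}

/-- The terms of index `r` and `-r` of the theta series `∑ (-1)^r z^r Q^(r(r-1)/2)`, added up,
where `z * w = Q`. -/
noncomputable def thetaCoeff (Q z w : ℂ) (r : ℕ) : ℂ :=
  if r = 0 then 1 else (-1) ^ r * Q ^ r.choose 2 * (z ^ r + w ^ r)

lemma sum_antidiagonal_two_mul (f : ℕ → ℕ → ℂ) (N : ℕ) :
    ∑ p ∈ antidiagonal (2 * N), f p.1 p.2 =
      ∑ p ∈ antidiagonal N, if p.1 = 0 then f N N else
        f (2 * p.1 + p.2) p.2 + f p.2 (2 * p.1 + p.2) := by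
  rw [Nat.sum_antidiagonal_eq_sum_range_succ (fun i j => f i j),
    Nat.sum_antidiagonal_eq_sum_range_succ (fun i j => if i = 0 then f N N else
        f (2 * i + j) j + f j (2 * i + j)), sum_range_succ' _ N,
    show (2 * N).succ = N + (1 + N) by omega, sum_range_add, sum_range_add]
  simp only [Nat.succ_ne_zero, if_false, if_true, sum_add_distrib]
  rw [← sum_range_reflect (fun i => f i (2 * N - i))]
  simp only [range_one, sum_singleton, add_zero]
  rw [show 2 * N - N = N by omega]
  have h1 : ∀ r ∈ range N, f (N - 1 - r) (2 * N - (N - 1 - r)) =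
      f (N - (r + 1)) (2 * (r + 1) + (N - (r + 1))) := by
    intro r hr
    have := mem_range.mp hr
    congr 1 <;> omega
  have h2 : ∀ r ∈ range N, f (N + (1 + r)) (2 * N - (N + (1 + r))) =
      f (2 * (r + 1) + (N - (r + 1))) (N - (r + 1)) := by
    intro r hr
    have := mem_range.mp hr
    congr 1 <;> omega
  rw [sum_congr rfl h1, sum_congr rfl h2]
  ring

lemma qPoch_reflect {d w : ℂ} {N : ℕ} (h : d * w * Q ^ N = Q) (hQ0 : Q ≠ 0) :
    qPoch Q d N = (-d) ^ N * Q ^ N.choose 2 * qPoch Q w N := by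
  have h1 : ∀ j ∈ range N, 1 - d * Q ^ j = (-d * Q ^ j) * (1 - w * Q ^ (N - 1 - j)) := by
    intro j hj
    have hj' := mem_range.mp hj
    have : d * w * Q ^ (N - 1 - j) * Q ^ j = 1 := by
      refine mul_right_cancel₀ hQ0 ?_
      rw [one_mul]
      calc _ = d * w * Q ^ (N - 1 - j + j + 1) := by ring
        _ = Q := by rw [show N - 1 - j + j + 1 = N by omega, h]
    linear_combination -this
  have h2 : ∏ j ∈ range N, (-d * Q ^ j) = (-d) ^ N * Q ^ N.choose 2 := by
    clear h h1
    induction N with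
    | zero => simp
    | succ n ih => rw [prod_range_succ, ih, choose_two_succ]; ring
  rw [qPoch, prod_congr rfl h1, prod_mul_distrib, h2,
    prod_range_reflect (fun j => 1 - w * Q ^ j), qPoch]

lemma finite_triple_product (hQ : ‖Q‖ < 1) (hQ0 : Q ≠ 0) {z w : ℂ} (hzw : z * w = Q) (N : ℕ) :
    ∑ p ∈ antidiagonal N, thetaCoeff Q z w p.1 *
        ((qPoch Q Q p.2)⁻¹ * (qPoch Q Q (2 * p.1 + p.2))⁻¹) =
      qPoch Q z N * qPoch Q w N / qPoch Q Q (2 * N) := by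
  have hz : z ≠ 0 := fun h => hQ0 (by rw [← hzw, h, zero_mul])
  have hQN := pow_ne_zero N hQ0
  obtain ⟨d, hd⟩ : ∃ d, d * Q ^ N = z := ⟨z / Q ^ N, div_mul_cancel₀ _ hQN⟩
  have hd0 : d ≠ 0 := fun h => hz (by rw [← hd, h, zero_mul])
  have hdw : d * w * Q ^ N = Q := by rw [mul_right_comm, hd, hzw]
  set g : ℕ → ℂ := fun m => (-d) ^ m * Q ^ m.choose 2 with hg
  have hg0 : g N ≠ 0 := mul_ne_zero (pow_ne_zero _ (neg_ne_zero.mpr hd0)) (pow_ne_zero _ hQ0)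
  refine mul_left_cancel₀ hg0 ?_
  have hz' : ∀ r, g (N + r) = g N * ((-1) ^ r * Q ^ r.choose 2 * z ^ r) := by
    intro r
    simp only [hg, choose_two_add, ← hd]
    rw [mul_pow, ← pow_mul, pow_add, pow_add, pow_add, ← neg_one_mul d, mul_pow, mul_pow]
    ring
  have hw' : ∀ r m, r + m = N → g m = g N * ((-1) ^ r * Q ^ r.choose 2 * w ^ r) := by
    rintro r m rfl
    have h1 : Q ^ (2 * r.choose 2) * Q ^ (m * r) * (d * w) ^ r = 1 := by
      refine mul_right_cancel₀ (pow_ne_zero r hQ0) ?_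
      rw [one_mul]
      nth_rw 4 [← hdw]
      rw [mul_pow _ (Q ^ (r + m)), ← pow_mul, show (r + m) * r = 2 * r.choose 2 + r + m * r by
        rw [← sq_eq_two_mul_choose_two_add]; ring]
      ring
    have h2 : ((-1 : ℂ) ^ r) * (-1) ^ r = 1 := by rw [← mul_pow]; simp
    have h3 : (-d) ^ r = (-1) ^ r * d ^ r := neg_pow d r
    simp only [hg, choose_two_add r m, pow_add, h3]
    rw [mul_pow] at h1
    linear_combination (-(-d) ^ m * Q ^ m.choose 2 * ((-1) ^ r * (-1) ^ r)) * h1 -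
      (-d) ^ m * Q ^ m.choose 2 * h2
  have hchu := q_chu_vandermonde hQ d (2 * N) 0
  have hone : ∀ n, qPoch Q 0 n = 1 := fun n => by simp [qPoch]
  simp only [zero_mul, hone, one_mul, mul_one] at hchu
  rw [two_mul, qPoch_add Q d, ← two_mul, hd, qPoch_reflect hdw hQ0,
    sum_antidiagonal_two_mul (fun i j => (-d) ^ i * Q ^ i.choose 2 /
      (qPoch Q Q i * qPoch Q Q j))] at hchu
  rw [show g N * (qPoch Q z N * qPoch Q w N / qPoch Q Q (2 * N)) =
    (-d) ^ N * Q ^ N.choose 2 * qPoch Q w N * qPoch Q z N / qPoch Q Q (2 * N) by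
      simp only [hg]; ring, ← hchu, mul_sum]
  refine sum_congr rfl fun p hp => ?_
  have hp' := mem_antidiagonal.mp hp
  by_cases h0 : p.1 = 0
  · have : p.2 = N := by omega
    simp only [thetaCoeff, h0, if_true, this, hg, mul_zero, zero_add]
    ring
  · have e1 := hz' p.1
    have e2 := hw' p.1 p.2 hp'
    rw [show N + p.1 = 2 * p.1 + p.2 by omega] at e1
    simp only [thetaCoeff, h0, if_false]
    change _ = g (2 * p.1 + p.2) / _ + g p.2 / _
    rw [e1, e2]
    ring

/-- The Jacobi triple product identity, with the theta series folded at the origin. -/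
lemma tsum_thetaCoeff (hQ : ‖Q‖ < 1) (hQ0 : Q ≠ 0) {z w : ℂ} (hzw : z * w = Q)
    (hs : Summable fun r => ‖thetaCoeff Q z w r‖) :
    ∑' r, thetaCoeff Q z w r = qPochInf Q z * qPochInf Q w * qPochInf Q Q := by
  have h1 := tendsto_sum_antidiagonal hs (tendsto_inv_qPoch_self hQ) (tendsto_inv_qPoch_self hQ)
  have h2 : Tendsto (fun N => qPoch Q z N * qPoch Q w N / qPoch Q Q (2 * N)) atTop
      (𝓝 (qPochInf Q z * qPochInf Q w / qPochInf Q Q)) :=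
    ((tendsto_qPoch hQ z).mul (tendsto_qPoch hQ w)).div
      ((tendsto_qPoch hQ Q).comp (tendsto_id.const_mul_atTop' two_pos))
      (qPochInf_self_ne_zero hQ)
  simp only [finite_triple_product hQ hQ0 hzw] at h1
  have h3 := tendsto_nhds_unique h1 h2
  have h4 := qPochInf_self_ne_zero hQ
  field_simp at h3
  rw [h3]
  ring

end TripleProduct

section MultiSum

/-- The sum of `∏ i, c i (n i) (n i + n (i + 1) + ⋯)` over the `m`-tuples `n` of total `N`. -/
noncomputable def multiSum (c : ℕ → ℕ → ℕ → ℂ) : ℕ → ℕ → ℂ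
  | 0, N => if N = 0 then 1 else 0
  | m + 1, N => ∑ p ∈ antidiagonal N, c 0 p.2 N * multiSum (fun i => c (i + 1)) m p.1

lemma Nsum_one (m : ℕ) (n : Fin m → ℕ) : Nsum m n 1 = ∑ j, n j := by
  simp [Nsum]

lemma Nsum_cons (m x : ℕ) (n : Fin m → ℕ) (i : ℕ) :
    Nsum (m + 1) (Fin.cons x n) (i + 2) = Nsum m n (i + 1) := by
  simp [Nsum, Fin.sum_univ_succ]

lemma Nsum_eq_add (m : ℕ) (n : Fin m → ℕ) (i : Fin m) :
    Nsum m n (i + 1) = n i + Nsum m n (i + 2) := by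
  have h : ∀ j : Fin m, (if (i : ℕ) + 1 ≤ j + 1 then n j else 0) =
      (if j = i then n j else 0) + if (i : ℕ) + 2 ≤ j + 1 then n j else 0 := by
    intro j
    by_cases hj : j = i
    · simp [hj]
    · have : (j : ℕ) ≠ i := fun h => hj (Fin.ext h)
      rw [if_neg hj, zero_add]
      exact if_congr (by omega) rfl rfl
  simp only [Nsum]
  rw [sum_congr rfl fun j _ => h j, sum_add_distrib, sum_ite_eq' univ i, if_pos (mem_univ i)]

lemma sum_antidiagonalTuple_succ (m N : ℕ) (f : (Fin (m + 1) → ℕ) → ℂ) :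
    ∑ n ∈ Nat.antidiagonalTuple (m + 1) N, f n =
      ∑ p ∈ antidiagonal N, ∑ n ∈ Nat.antidiagonalTuple m p.1, f (Fin.cons p.2 n) := by
  rw [sum_sigma']
  refine sum_nbij' (fun n => ⟨(∑ j, Fin.tail n j, n 0), Fin.tail n⟩)
    (fun x => Fin.cons x.1.2 x.2) ?_ ?_ ?_ ?_ ?_
  · intro n hn
    rw [Nat.mem_antidiagonalTuple, Fin.sum_univ_succ] at hn
    simp only [mem_sigma, HasAntidiagonal.mem_antidiagonal, Nat.mem_antidiagonalTuple, and_true]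
    rw [← hn, add_comm]
    rfl
  · rintro ⟨p, n⟩ h
    simp only [mem_sigma, HasAntidiagonal.mem_antidiagonal, Nat.mem_antidiagonalTuple] at h ⊢
    rw [Fin.sum_univ_succ]
    simp only [Fin.cons_zero, Fin.cons_succ]
    omega
  · intro n _
    exact Fin.cons_self_tail n
  · rintro ⟨⟨M, x⟩, n⟩ h
    simp only [mem_sigma, HasAntidiagonal.mem_antidiagonal, Nat.mem_antidiagonalTuple] at h
    obtain ⟨-, rfl⟩ := h
    simp
  · intro n _
    simp

lemma sum_antidiagonalTuple_eq_multiSum (c : ℕ → ℕ → ℕ → ℂ) (m N : ℕ) :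
    ∑ n ∈ Nat.antidiagonalTuple m N, ∏ i : Fin m, c i (n i) (Nsum m n (i + 1)) =
      multiSum c m N := by
  induction m generalizing c N with
  | zero => rcases N with _ | N <;> simp [multiSum]
  | succ m ih =>
    rw [sum_antidiagonalTuple_succ, multiSum]
    refine sum_congr rfl fun p hp => ?_
    rw [← ih, mul_sum]
    refine sum_congr rfl fun n hn => ?_
    rw [Fin.prod_univ_succ]
    congr 1
    · rw [Fin.val_zero, zero_add, Nsum_one, Fin.sum_univ_succ]
      simp only [Fin.cons_zero, Fin.cons_succ]
      rw [Nat.mem_antidiagonalTuple.mp hn, add_comm p.2, mem_antidiagonal.mp hp]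
    · refine prod_congr rfl fun i _ => ?_
      rw [Fin.cons_succ, Fin.val_succ, ← Nsum_cons m p.2 n i]

lemma summable_prod_pi {g : ℕ → ℝ} (hg : ∀ n, 0 ≤ g n) (hs : Summable g) (m : ℕ) :
    Summable fun n : Fin m → ℕ => ∏ i, g (n i) := by
  induction m with
  | zero => exact Summable.of_finite
  | succ m ih =>
    rw [← (Fin.consEquiv fun _ : Fin (m + 1) => ℕ).summable_iff]
    have h := hs.mul_of_nonneg ih hg fun n => prod_nonneg fun i _ => hg _
    refine h.congr fun x => ?_
    simp [Fin.prod_univ_succ, Fin.consEquiv]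

lemma summable_and_tsum_sum_antidiagonalTuple {m : ℕ} {f : (Fin m → ℕ) → ℂ} (hf : Summable fun n => ‖f n‖) :
    Summable (fun N => ‖∑ n ∈ Nat.antidiagonalTuple m N, f n‖) ∧
      ∑' N, ∑ n ∈ Nat.antidiagonalTuple m N, f n = ∑' n, f n := by
  set e := Nat.sigmaAntidiagonalTupleEquivTuple m
  have h1 : Summable fun x => ‖f (e x)‖ := e.summable_iff.mpr hf
  constructor
  · refine h1.sigma.of_nonneg_of_le (fun _ => norm_nonneg _) fun N => ?_
    refine (norm_sum_le _ _).trans_eq ?_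
    exact (Finset.tsum_subtype (Nat.antidiagonalTuple m N) fun n => ‖f n‖).symm
  · rw [← e.tsum_eq f, h1.of_norm.tsum_sigma]
    refine tsum_congr fun N => ?_
    exact (Finset.tsum_subtype (Nat.antidiagonalTuple m N) f).symm

end MultiSum

section Andrews

/-- The factor with (zero-based) index `i` of the summand, where `b = a - 2`. -/
noncomputable def owCoeff (q : ℂ) (b i x N : ℕ) : ℂ :=
  q ^ (N ^ 2 + if i < b then (if i % 2 = 0 then x else 0) else N) / qPoch (q ^ 2) (q ^ 2) x

variable {q : ℂ}

lemma pow_sq_add (q : ℂ) (n : ℕ) :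
    q ^ (n ^ 2 + n) = (-(-q ^ 2)) ^ n * (q ^ 2) ^ n.choose 2 := by
  rw [neg_neg, ← pow_add, ← pow_mul, sq_eq_two_mul_choose_two_add]
  ring

lemma baileySum_one_eq_thetaCoeff {Q : ℂ} (hQ : ‖Q‖ < 1) (b : ℂ) (s N : ℕ) :
    baileySum Q b 1 (fun r => (-1) ^ r * Q ^ r.choose 2 * Q ^ (s * (r.choose 2 + r)) *
      (1 - Q ^ (2 * r + 1))) N = baileySum Q b 0 (thetaCoeff (Q ^ (s + 1)) Q (Q ^ s)) N := by
  refine baileySum_one_eq_baileySum_zero hQ b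
    (A := fun r => (-1) ^ r * Q ^ r.choose 2 * Q ^ (s * (r.choose 2 + r))) ?_ ?_ N
  · simp [thetaCoeff]
  · intro r
    simp only [thetaCoeff, Nat.succ_ne_zero, if_false, choose_two_succ]
    ring

lemma thetaCoeff_mul_pow_sq (Q X z w : ℂ) (r : ℕ) :
    thetaCoeff X z w r * Q ^ r ^ 2 = thetaCoeff (X * Q ^ 2) (z * Q) (w * Q) r := by
  rcases r with _ | r
  · simp [thetaCoeff]
  · simp only [thetaCoeff, Nat.succ_ne_zero, if_false, sq_eq_two_mul_choose_two_add]
    ring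

lemma multiSum_owCoeff_zero (hq : ‖q ^ 2‖ < 1) (s N : ℕ) :
    multiSum (owCoeff q 0) s N = q ^ (N ^ 2 + N) *
      baileySum (q ^ 2) (-q ^ 2) 1 (fun r => (-1) ^ r * (q ^ 2) ^ r.choose 2 *
        (q ^ 2) ^ (s * (r.choose 2 + r)) * (1 - (q ^ 2) ^ (2 * r + 1))) N := by
  induction s generalizing N with
  | zero =>
    rw [baileySum_one_eq_thetaCoeff hq, baileySum_unit_zero hq, multiSum]
    · split_ifs with h <;> simp [h]
    · simp [thetaCoeff]
    · intro r
      simp [thetaCoeff, add_comm]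
  | succ s ih =>
    have h := bailey_step (b := -q ^ 2) (d := -q ^ 2) (e := 1) hq (by ring)
      (qPoch_neg_self_ne_zero hq) (fun r => (-1) ^ r * (q ^ 2) ^ r.choose 2 *
        (q ^ 2) ^ (s * (r.choose 2 + r)) * (1 - (q ^ 2) ^ (2 * r + 1))) N
    simp only [← pow_sq_add, ← ih] at h
    have hc : (fun i => owCoeff q 0 (i + 1)) = owCoeff q 0 := by
      funext i x M
      simp [owCoeff]
    have hα : (fun r : ℕ => (-1) ^ r * (q ^ 2) ^ r.choose 2 *
        (q ^ 2) ^ (s * (r.choose 2 + r)) * (1 - (q ^ 2) ^ (2 * r + 1)) *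
        (q ^ (r ^ 2 + r) * qPoch (q ^ 2) (-q ^ 2) r / qPoch (q ^ 2) (-q ^ 2) r)) =
        fun r => (-1) ^ r * (q ^ 2) ^ r.choose 2 *
        (q ^ 2) ^ ((s + 1) * (r.choose 2 + r)) * (1 - (q ^ 2) ^ (2 * r + 1)) := by
      funext r
      rw [mul_div_cancel_right₀ _ (qPoch_neg_self_ne_zero hq r), sq_eq_two_mul_choose_two_add]
      ring
    rw [hα] at h
    rw [← h, multiSum, hc, mul_sum]
    refine sum_congr rfl fun p _ => ?_
    simp only [owCoeff, Nat.not_lt_zero, if_false]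
    ring

lemma sum_multiSum_owCoeff (hq : ‖q ^ 2‖ < 1) (s j N : ℕ) :
    ∑ p ∈ antidiagonal N, multiSum (owCoeff q (2 * j)) (s + 2 * j) p.1 / qPoch (q ^ 2) (q ^ 2) p.2 =
      baileySum (q ^ 2) (-q ^ 2) 0 (thetaCoeff ((q ^ 2) ^ (s + 2 * j + 2)) ((q ^ 2) ^ (j + 1))
        ((q ^ 2) ^ (s + j + 1))) N := by
  induction j generalizing N with
  | zero =>
    have h := bailey_step (b := -q ^ 2) (d := -q ^ 2) (e := 1) hq (by ring)
      (qPoch_neg_self_ne_zero hq) (fun r => (-1) ^ r * (q ^ 2) ^ r.choose 2 *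
        (q ^ 2) ^ (s * (r.choose 2 + r)) * (1 - (q ^ 2) ^ (2 * r + 1))) N
    simp only [← pow_sq_add, ← multiSum_owCoeff_zero hq] at h
    simp only [mul_zero, add_zero, zero_add, pow_one]
    rw [h, ← baileySum_one_eq_thetaCoeff hq]
    congr 1
    funext r
    rw [mul_div_cancel_right₀ _ (qPoch_neg_self_ne_zero hq r), sq_eq_two_mul_choose_two_add]
    ring
  | succ j ih =>
    set α := thetaCoeff ((q ^ 2) ^ (s + 2 * j + 2)) ((q ^ 2) ^ (j + 1)) ((q ^ 2) ^ (s + j + 1))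
    have hA := bailey_step (b := -q ^ 2) (d := -1) (e := 0) hq (by ring)
      (qPoch_neg_one_ne_zero hq) α
    have hB := bailey_step (b := -1) (d := -q ^ 2) (e := 0) hq (by ring)
      (qPoch_neg_self_ne_zero hq)
      (fun r => α r * ((-(-1)) ^ r * (q ^ 2) ^ r.choose 2 * qPoch (q ^ 2) (-q ^ 2) r /
        qPoch (q ^ 2) (-1) r)) N
    have hα : (fun r => α r * ((-(-1)) ^ r * (q ^ 2) ^ r.choose 2 * qPoch (q ^ 2) (-q ^ 2) r /
        qPoch (q ^ 2) (-1) r) * ((-(-q ^ 2)) ^ r * (q ^ 2) ^ r.choose 2 * qPoch (q ^ 2) (-1) r /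
        qPoch (q ^ 2) (-q ^ 2) r)) = thetaCoeff ((q ^ 2) ^ (s + 2 * (j + 1) + 2))
        ((q ^ 2) ^ (j + 1 + 1)) ((q ^ 2) ^ (s + (j + 1) + 1)) := by
      funext r
      have h1 := qPoch_neg_one_ne_zero hq r
      have h2 := qPoch_neg_self_ne_zero hq r
      have h3 := thetaCoeff_mul_pow_sq (q ^ 2) ((q ^ 2) ^ (s + 2 * j + 2)) ((q ^ 2) ^ (j + 1))
        ((q ^ 2) ^ (s + j + 1)) r
      rw [show s + 2 * (j + 1) + 2 = s + 2 * j + 2 + 2 by ring,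
        show s + (j + 1) + 1 = s + j + 1 + 1 by ring, pow_add _ (s + 2 * j + 2) 2,
        pow_succ _ (j + 1), pow_succ _ (s + j + 1), ← h3, sq_eq_two_mul_choose_two_add]
      simp only [neg_neg, one_pow, one_mul]
      field_simp
      ring
    rw [← hα, ← hB]
    refine sum_congr rfl fun p _ => ?_
    rw [← hA, ← pow_sq_add]
    congr 1
    rw [show s + 2 * (j + 1) = s + 2 * j + 1 + 1 by ring, multiSum, mul_sum]
    refine sum_congr rfl fun t ht => ?_
    rw [multiSum, ← ih, mul_sum, mul_sum, sum_div, mul_sum]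
    refine sum_congr rfl fun u _ => ?_
    have hc : (fun i => owCoeff q (2 * (j + 1)) (i + 1 + 1)) = owCoeff q (2 * j) := by
      funext i x M
      simp only [owCoeff, mul_add, mul_one]
      congr 3
      simp [add_assoc]
    have h0 : (0 : ℕ) < 2 * (j + 1) := by omega
    have h1 : 0 + 1 < 2 * (j + 1) := by omega
    have hexp : q ^ (p.1 ^ 2 + t.2) * q ^ (t.1 ^ 2 + 0) =
        q ^ (p.1 ^ 2 + p.1) * (q ^ 2) ^ t.1.choose 2 := by
      rw [← pow_mul, ← pow_add, ← pow_add, sq_eq_two_mul_choose_two_add t.1,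
        ← mem_antidiagonal.mp ht]
      congr 1
      ring
    rw [hc]
    simp only [owCoeff, h0, h1, if_true]
    norm_num only [if_false, neg_neg, one_pow, one_mul]
    rw [add_zero] at hexp
    linear_combination (multiSum (owCoeff q (2 * j)) (s + 2 * j) u.1 /
      (qPoch (q ^ 2) (q ^ 2) t.2 * qPoch (q ^ 2) (q ^ 2) u.2)) * hexp

end Andrews

section Limit

open Filter Topology

variable {q : ℂ}

lemma owTerm_eq_prod_owCoeff (k j : ℕ) (hjk : 2 * j + 2 ≤ k) (q : ℂ) (n : Fin (k - 1) → ℕ) :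
    owTerm k (2 * j + 2) q n =
      ∏ i : Fin (k - 1), owCoeff q (2 * j) i (n i) (Nsum (k - 1) n (i + 1)) := by
  simp only [owTerm, owCoeff]
  rw [prod_div_distrib, prod_pow_eq_pow_sum]
  congr 2
  generalize hm : k - 1 = m at n
  set S := Nsum m n
  have hS : ∀ i : Fin m, n i = S (i + 1) - S (i + 1 + 1) := by
    intro i
    have : S (i + 1) = n i + S (i + 1 + 1) := Nsum_eq_add m n i
    omega
  have hodd : (Icc 1 (2 * j + 2 - 3)).filter (fun i => i % 2 = 1) =
      (Icc 1 m).filter (fun i => i ≤ 2 * j ∧ i % 2 = 1) := by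
    ext i
    simp only [mem_filter, mem_Icc]
    omega
  have htail : Icc (2 * j + 2 - 1) m = (Icc 1 m).filter (fun i => ¬ i ≤ 2 * j) := by
    ext i
    simp only [mem_filter, mem_Icc]
    omega
  rw [hodd, htail, sum_filter, sum_filter, ← sum_add_distrib, ← sum_add_distrib]
  simp only [hS]
  rw [Fin.sum_univ_eq_sum_range (fun i => S (i + 1) ^ 2 +
      if i < 2 * j then if i % 2 = 0 then S (i + 1) - S (i + 1 + 1) else 0 else S (i + 1)) m,
    ← Finset.Ico_add_one_right_eq_Icc, sum_Ico_eq_sum_range, Nat.add_sub_cancel]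
  refine sum_congr rfl fun i _ => ?_
  rw [add_comm 1 i, add_assoc]
  congr 1
  by_cases h1 : i < 2 * j
  · have h2 : i + 1 ≤ 2 * j := h1
    by_cases h3 : i % 2 = 0
    · have h4 : (i + 1) % 2 = 1 := by omega
      simp [h1, h2, h3, h4]
    · have h4 : ¬ (i + 1) % 2 = 1 := by omega
      simp [h1, h2, h3, h4]
  · have h2 : ¬ i + 1 ≤ 2 * j := h1
    simp [h1, h2]

lemma norm_sq_lt_one (hq : ‖q‖ < 1) : ‖q ^ 2‖ < 1 := by
  rw [norm_pow]
  exact pow_lt_one₀ (norm_nonneg _) hq two_ne_zero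

lemma summable_norm_prod_owCoeff (hq : ‖q‖ < 1) (b m : ℕ) :
    Summable fun n : Fin m → ℕ => ‖∏ i : Fin m, owCoeff q b i (n i) (Nsum m n (i + 1))‖ := by
  obtain ⟨C, hC⟩ := (Metric.isBounded_range_of_tendsto _
    (tendsto_inv_qPoch_self (norm_sq_lt_one hq))).exists_norm_le
  have hC' : ∀ n, ‖(qPoch (q ^ 2) (q ^ 2) n)⁻¹‖ ≤ C := fun n => hC _ ⟨n, rfl⟩
  have hC0 : 0 ≤ C := (norm_nonneg _).trans (hC' 0)
  refine (summable_prod_pi (g := fun x => ‖q‖ ^ x * C)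
    (fun x => mul_nonneg (pow_nonneg (norm_nonneg _) _) hC0)
    ((summable_geometric_of_lt_one (norm_nonneg _) hq).mul_right C) m).of_nonneg_of_le
    (fun _ => norm_nonneg _) fun n => ?_
  rw [norm_prod]
  refine prod_le_prod (fun _ _ => norm_nonneg _) fun i _ => ?_
  rw [owCoeff, div_eq_mul_inv, norm_mul, norm_pow]
  refine mul_le_mul ?_ (hC' _) (norm_nonneg _) (pow_nonneg (norm_nonneg _) _)
  refine pow_le_pow_of_le_one (norm_nonneg _) hq.le ?_
  calc n i ≤ Nsum m n (i + 1) := by rw [Nsum_eq_add]; omega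
    _ ≤ Nsum m n (i + 1) ^ 2 := Nat.le_self_pow two_ne_zero _
    _ ≤ _ := Nat.le_add_right _ _

lemma summable_norm_thetaCoeff {Q X z w : ℂ} (hQ : ‖Q‖ < 1) (hX : ‖X‖ ≤ 1) (hz : ‖z‖ ≤ ‖Q‖)
    (hw : ‖w‖ ≤ ‖Q‖) : Summable fun r => ‖thetaCoeff X z w r‖ := by
  refine ((summable_geometric_of_lt_one (norm_nonneg _) hQ).mul_left 2).of_nonneg_of_le
    (fun _ => norm_nonneg _) fun r => ?_
  rcases r with _ | r
  · simp [thetaCoeff]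
  · simp only [thetaCoeff, Nat.succ_ne_zero, if_false, norm_mul, norm_pow, norm_neg, norm_one,
      one_pow, one_mul]
    have h1 : ‖X‖ ^ (r + 1).choose 2 ≤ 1 := pow_le_one₀ (norm_nonneg _) hX
    have h2 : ‖z ^ (r + 1) + w ^ (r + 1)‖ ≤ 2 * ‖Q‖ ^ (r + 1) := by
      refine (norm_add_le _ _).trans ?_
      rw [norm_pow, norm_pow, two_mul]
      gcongr
    exact (mul_le_mul h1 h2 (norm_nonneg _) zero_le_one).trans_eq (one_mul _)

lemma tsum_multiSum_owCoeff (hq : ‖q‖ < 1) (s j : ℕ)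
    (hs : Summable fun N => ‖multiSum (owCoeff q (2 * j)) (s + 2 * j) N‖) :
    ∑' N, multiSum (owCoeff q (2 * j)) (s + 2 * j) N =
      qPochInf (q ^ 2) (-q ^ 2) * (qPochInf ((q ^ 2) ^ (s + 2 * j + 2)) ((q ^ 2) ^ (j + 1)) *
        qPochInf ((q ^ 2) ^ (s + 2 * j + 2)) ((q ^ 2) ^ (s + j + 1)) *
        qPochInf ((q ^ 2) ^ (s + 2 * j + 2)) ((q ^ 2) ^ (s + 2 * j + 2))) /
        qPochInf (q ^ 2) (q ^ 2) := by
  have hQ := norm_sq_lt_one hq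
  have hpow : ∀ e, ‖(q ^ 2) ^ (e + 1)‖ ≤ ‖q ^ 2‖ := fun e => by
    rw [norm_pow]
    exact pow_le_of_le_one (norm_nonneg _) hQ.le e.succ_ne_zero
  have hX := (hpow (s + 2 * j + 1)).trans_lt hQ
  have hθ := summable_norm_thetaCoeff hQ hX.le (hpow j) (hpow (s + j))
  have hl := tendsto_sum_antidiagonal hs (tendsto_inv_qPoch_self hQ)
    (tendsto_const_nhds (x := (1 : ℂ)))
  simp only [mul_one, ← div_eq_mul_inv, sum_multiSum_owCoeff hQ] at hl
  have h := tendsto_nhds_unique hl (tendsto_baileySum_zero hQ (-q ^ 2) hθ)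
  have htheta : ∑' r, thetaCoeff ((q ^ 2) ^ (s + 2 * j + 2)) ((q ^ 2) ^ (j + 1))
      ((q ^ 2) ^ (s + j + 1)) r =
      qPochInf ((q ^ 2) ^ (s + 2 * j + 2)) ((q ^ 2) ^ (j + 1)) *
        qPochInf ((q ^ 2) ^ (s + 2 * j + 2)) ((q ^ 2) ^ (s + j + 1)) *
        qPochInf ((q ^ 2) ^ (s + 2 * j + 2)) ((q ^ 2) ^ (s + 2 * j + 2)) := by
    by_cases hq0 : q = 0
    · subst hq0
      rw [tsum_eq_single 0 fun r hr => by simp [thetaCoeff, hr]]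
      simp [thetaCoeff, qPochInf]
    · refine tsum_thetaCoeff hX (pow_ne_zero _ (pow_ne_zero _ hq0)) ?_ hθ
      rw [← pow_add]
      congr 1
      ring
  rw [htheta] at h
  have hP := qPochInf_self_ne_zero hQ
  field_simp at h ⊢
  linear_combination h

end Limit

/-- Andrews' product-multisum identity for `\overline{W}_{k,a}` with `k` odd, `a` even. -/
theorem andrews_OW_multisum (k a : ℕ) (ha : 2 ≤ a) (hak : a ≤ k)
    (hk : Odd k) (haeven : Even a) (q : ℂ) (hq : ‖q‖ < 1) :
    Summable (owTerm k a q) ∧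
    qPochInf (q ^ 2) (-(q ^ 2)) * qPochInf (q ^ (2 * k + 2)) (q ^ a) *
        qPochInf (q ^ (2 * k + 2)) (q ^ (2 * k + 2 - a)) *
        qPochInf (q ^ (2 * k + 2)) (q ^ (2 * k + 2)) / qPochInf (q ^ 2) (q ^ 2) =
      ∑' n : Fin (k - 1) → ℕ, owTerm k a q n := by
  obtain ⟨j, rfl⟩ : ∃ j, a = 2 * j + 2 := by
    obtain ⟨c, rfl⟩ := haeven
    exact ⟨c - 1, by omega⟩
  obtain ⟨s, rfl⟩ : ∃ s, k = s + 2 * j + 1 := ⟨k - (2 * j + 1), by omega⟩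
  have hterm := funext (owTerm_eq_prod_owCoeff (s + 2 * j + 1) j hak q)
  have hsum : Summable fun n => ‖owTerm (s + 2 * j + 1) (2 * j + 2) q n‖ := by
    rw [hterm]
    exact summable_norm_prod_owCoeff hq _ _
  refine ⟨hsum.of_norm, ?_⟩
  obtain ⟨h1, h2⟩ := summable_and_tsum_sum_antidiagonalTuple hsum
  simp only [hterm, sum_antidiagonalTuple_eq_multiSum] at h1 h2
  simp only [hterm]
  rw [← h2, Nat.add_sub_cancel, tsum_multiSum_owCoeff hq s j h1]
  simp only [← pow_mul]
  rw [show 2 * (s + 2 * j + 2) = 2 * (s + 2 * j + 1) + 2 by ring,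
    show 2 * (s + j + 1) = 2 * (s + 2 * j + 1) + 2 - (2 * j + 2) by omega,
    show 2 * (j + 1) = 2 * j + 2 by ring]
  ring
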